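/- Let D ≥ 1, k ≥ 1 and b ≥ 0 be integers, and define f : ℕ³ → ℕ by f(D,b,k) = 1 whenever k = 1 or b = 0, and f(D,b,k) = f(D,b,k-1) + (D-1)·f(D,b-1,k-1) whenever k ≥ 2 and b ≥ 1. Let T be a finite rooted tree whose maximum degree (as a graph) is at most D and whose binary-minor depth b(T) is at most b. If every root-to-leaf path in T contains fewer than k vertices having at least two children, then T has at most f(D,b,k) leaves. -/

import Mathlib

/-- A finite rooted tree: a node together with a finite list of child subtrees. -/
inductive RTree : Type where
  | node : List RTree → RTree

namespace RTree

/-- The number of children of the root of a tree. -/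
def numChildren : RTree → ℕ
  | .node ts => ts.length

/-- The number of leaves of a tree (a single vertex is one leaf). -/
def leaves : RTree → ℕ
  | .node [] => 1
  | .node (t :: ts) => ((t :: ts).attach.map fun ⟨s, _⟩ => leaves s).sum

/-- Auxiliary: maximum degree over the vertices of a tree, where every vertex
(including the root of this subtree) is regarded as a non-root vertex, so that
its degree is its number of children plus one (for the edge to its parent). -/
def maxDegAux : RTree → ℕ
  | .node ts =>
    max (ts.length + 1) ((ts.attach.map fun ⟨s, _⟩ => maxDegAux s).foldr max 0)

/-- The maximum degree of a rooted tree seen as a graph: the degree of the root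
is its number of children, and the degree of any other vertex is its number of
children plus one. -/
def maxDegree : RTree → ℕ
  | .node ts =>
    max ts.length ((ts.attach.map fun ⟨s, _⟩ => maxDegAux s).foldr max 0)

/-- The binary-minor depth `b(T)`: the maximum depth of a rooted complete binary
tree appearing in `T` as a rooted minor.  Recursively, `b(T) = 0` for a single
vertex, and otherwise `b(T) = max (M₁) (M₂ + 1)` where `M₁ ≥ M₂` are the two
largest values of `b` over the children subtrees of the root (with `M₂ = 0` if
the root has only one child). -/
def bDepth : RTree → ℕ
  | .node [] => 0
  | .node (t :: ts) =>
    let l := (t :: ts).attach.map fun ⟨s, _⟩ => bDepth s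
    let M₁ := l.foldr max 0
    let M₂ := (l.erase M₁).foldr max 0
    max M₁ (M₂ + 1)

/-- `RootLeafPath T p` holds when `p` is the sequence of vertices (identified
with the subtrees rooted at them) of a path from the root of `T` to a leaf
of `T`. -/
inductive RootLeafPath : RTree → List RTree → Prop where
  | leaf : RootLeafPath (.node []) [.node []]
  | step {ts : List RTree} {t : RTree} {p : List RTree} :
      t ∈ ts → RootLeafPath t p → RootLeafPath (.node ts) (.node ts :: p)

end RTree

/-- The function `f(D, b, k)` of Lemma 3.6: `f(D,b,k) = 1` if `k = 1` or
`b = 0`, and `f(D,b,k) = f(D,b,k-1) + (D-1)·f(D,b-1,k-1)` if `k ≥ 2`, `b ≥ 1`. -/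
def fDBK (D : ℕ) : ℕ → ℕ → ℕ
  | _, 0 => 1
  | 0, _ => 1
  | _, 1 => 1
  | b + 1, k + 2 => fDBK D (b + 1) (k + 1) + (D - 1) * fDBK D b (k + 1)

namespace RTree

theorem induction_children {P : RTree → Prop}
    (h : ∀ ts : List RTree, (∀ t ∈ ts, P t) → P (.node ts)) : ∀ T : RTree, P T
  | .node ts => h ts fun t _ => induction_children h t

theorem le_foldr_max {l : List ℕ} {a : ℕ} (h : a ∈ l) : a ≤ l.foldr max 0 := by
  induction l with
  | nil => simp at h
  | cons x l ih =>
    rcases List.mem_cons.1 h with rfl | h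
    · exact le_max_left _ _
    · exact (ih h).trans (le_max_right _ _)

theorem foldr_max_mem {l : List ℕ} (h : l ≠ []) : l.foldr max 0 ∈ l := by
  induction l with
  | nil => exact absurd rfl h
  | cons x l ih =>
    rcases eq_or_ne l [] with rfl | hl
    · simp
    · rcases max_choice x (l.foldr max 0) with hx | hx
      · simp [hx]
      · simp only [List.foldr_cons, hx]
        exact List.mem_cons_of_mem _ (ih hl)

theorem leaves_node {ts : List RTree} (h : ts ≠ []) :
    leaves (.node ts) = (ts.map leaves).sum := by
  cases ts with
  | nil => exact absurd rfl h
  | cons t ts => rw [leaves]; simp only [List.attach_map_val]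

theorem bDepth_node {ts : List RTree} (h : ts ≠ []) :
    bDepth (.node ts) = max ((ts.map bDepth).foldr max 0)
      (((ts.map bDepth).erase ((ts.map bDepth).foldr max 0)).foldr max 0 + 1) := by
  cases ts with
  | nil => exact absurd rfl h
  | cons t ts => rw [bDepth]; simp only [List.attach_map_val]

theorem maxDegree_le_maxDegAux (T : RTree) : maxDegree T ≤ maxDegAux T := by
  cases T with
  | node ts =>
    rw [maxDegree, maxDegAux]
    exact max_le_max (Nat.le_succ _) le_rfl

theorem length_le_maxDegree (ts : List RTree) : ts.length ≤ maxDegree (.node ts) := by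
  rw [maxDegree]
  exact le_max_left _ _

theorem maxDegree_child_le {ts : List RTree} {t : RTree} (h : t ∈ ts) :
    maxDegree t ≤ maxDegree (.node ts) := by
  refine (maxDegree_le_maxDegAux t).trans ?_
  rw [maxDegree]
  simp only [List.attach_map_val]
  exact (le_foldr_max (List.mem_map_of_mem h)).trans (le_max_right _ _)

/-- Some child carries the largest binary-minor depth; the remaining children have
binary-minor depth strictly smaller than the whole tree. -/
theorem exists_perm_bDepth {ts : List RTree} (h : ts ≠ []) :
    ∃ t l, ts.Perm (t :: l) ∧ bDepth t ≤ bDepth (.node ts) ∧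
      ∀ s ∈ l, bDepth s + 1 ≤ bDepth (.node ts) := by
  obtain ⟨t, ht, hmax⟩ := List.mem_map.1 (foldr_max_mem (l := ts.map bDepth) (by simpa using h))
  obtain ⟨l₁, l₂, rfl⟩ := List.append_of_mem ht
  have hperm : (l₁ ++ t :: l₂).Perm (t :: (l₁ ++ l₂)) := List.perm_middle
  refine ⟨t, l₁ ++ l₂, hperm, ?_, fun s hs => ?_⟩
  · rw [bDepth_node h, hmax]
    exact le_max_left _ _
  · rw [bDepth_node h, ← hmax]
    refine le_trans (Nat.succ_le_succ (le_foldr_max ?_)) (le_max_right _ _)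
    have he := (hperm.map bDepth).erase (bDepth t)
    rw [List.map_cons, List.erase_cons_head] at he
    exact he.mem_iff.2 (List.mem_map_of_mem hs)

theorem one_le_bDepth_node {ts : List RTree} (h : ts ≠ []) : 1 ≤ bDepth (.node ts) := by
  rw [bDepth_node h]
  exact (Nat.le_add_left _ _).trans (le_max_right _ _)

theorem exists_rootLeafPath (T : RTree) : ∃ p, RootLeafPath T p := by
  induction T using induction_children with
  | h ts ih =>
    cases ts with
    | nil => exact ⟨_, .leaf⟩
    | cons t ts =>
      obtain ⟨p, hp⟩ := ih t (by simp)
      exact ⟨_, .step (by simp) hp⟩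

end RTree

theorem one_le_fDBK (D b k : ℕ) : 1 ≤ fDBK D b k := by
  induction k generalizing b with
  | zero => simp [fDBK]
  | succ k ih =>
    cases b with
    | zero => simp [fDBK]
    | succ b =>
      cases k with
      | zero => simp [fDBK]
      | succ k => exact (ih (b + 1)).trans (by rw [fDBK]; exact Nat.le_add_right _ _)

open RTree in
/-- Lemma 3.6: if `T` is a rooted tree of maximum degree at most `D` with
`b(T) ≤ b`, and every root-to-leaf path of `T` contains fewer than `k`
vertices with at least two children, then `T` has at most `f(D,b,k)` leaves. -/
theorem stmt_0 (D b k : ℕ) (hD : 1 ≤ D) (hk : 1 ≤ k) (T : RTree)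
    (hdeg : maxDegree T ≤ D) (hb : bDepth T ≤ b)
    (hpath : ∀ p : List RTree, RootLeafPath T p →
      (p.countP fun t => decide (2 ≤ numChildren t)) < k) :
    leaves T ≤ fDBK D b k := by
  induction T using induction_children generalizing b k with
  | h ts ih =>
    rcases eq_or_ne ts [] with rfl | hne
    · simpa [leaves] using one_le_fDBK D b k
    obtain ⟨t, l, hperm, ht, hl⟩ := exists_perm_bDepth hne
    have htm : t ∈ ts := hperm.mem_iff.2 (by simp)
    have hlm : ∀ s ∈ l, s ∈ ts := fun s hs => hperm.mem_iff.2 (by simp [hs])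
    have hlen : ts.length = l.length + 1 := by simpa using hperm.length_eq
    have hleaves : leaves (.node ts) = leaves t + (l.map leaves).sum := by
      rw [leaves_node hne, (hperm.map leaves).sum_eq, List.map_cons, List.sum_cons]
    have hdeg' : ∀ s ∈ ts, maxDegree s ≤ D := fun s hs => (maxDegree_child_le hs).trans hdeg
    have hlenD : l.length ≤ D - 1 := by
      have := (length_le_maxDegree ts).trans hdeg
      omega
    rw [hleaves]
    rcases eq_or_ne l [] with rfl | hlne
    · refine ih t htm b k hk (hdeg' t htm) (ht.trans hb) fun p hp => ?_
      exact lt_of_le_of_lt ((List.sublist_cons_self _ _).countP_le) (hpath _ (.step htm hp))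
    · have hbranch : 2 ≤ ts.length := by
        have := List.length_pos_iff.2 hlne
        omega
      have hpath' : ∀ s ∈ ts, ∀ p, RootLeafPath s p →
          (p.countP fun t => decide (2 ≤ numChildren t)) + 1 < k := fun s hs p hp => by
        have := hpath _ (.step hs hp)
        rwa [List.countP_cons_of_pos (by exact decide_eq_true hbranch)] at this
      obtain ⟨b, rfl⟩ : ∃ c, b = c + 1 :=
        Nat.exists_eq_succ_of_ne_zero (by have := one_le_bDepth_node hne; omega)
      obtain ⟨k, rfl⟩ : ∃ m, k = m + 2 := by
        obtain ⟨p, hp⟩ := exists_rootLeafPath t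
        exact Nat.exists_eq_add_of_le' (by have := hpath' t htm p hp; omega)
      rw [fDBK]
      refine Nat.add_le_add ?_ ?_
      · exact ih t htm (b + 1) (k + 1) (by omega) (hdeg' t htm) (ht.trans hb)
          fun p hp => by have := hpath' t htm p hp; omega
      · have hsum : (l.map leaves).sum ≤ l.length * fDBK D b (k + 1) := by
          simpa using List.sum_le_card_nsmul (l.map leaves) (fDBK D b (k + 1)) (by
            simp only [List.mem_map, forall_exists_index, and_imp, forall_apply_eq_imp_iff₂]
            intro s hs
            exact ih s (hlm s hs) b (k + 1) (by omega) (hdeg' s (hlm s hs))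
              (by have := hl s hs; omega)
              fun p hp => by have := hpath' s (hlm s hs) p hp; omega)
        exact hsum.trans (Nat.mul_le_mul_right _ hlenD)
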